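/- Let ι be a finite index set and for each i ∈ ι let (Ω_i, 𝓕_i, P_i) be a probability space. Let 𝒞 be a partition of ι into pairwise disjoint nonempty blocks whose union is ι. For each block c ∈ 𝒞 let B^c_1, …, B^c_{d_c} be finitely many measurable subsets of ∏_{i∈ι} Ω_i that are pairwise disjoint, have union equal to the whole product space, and are each determined by coordinates in c. Then there exist probability measures Q_i on Ω_i (i ∈ ι), where Q_i is finitely supported with at most d_c atoms whenever i belongs to block c, such that for every choice of indices (k_c)_{c∈𝒞} with 1 ≤ k_c ≤ d_c one has (⨂_{i∈ι} Q_i)(⋂_{c∈𝒞} B^c_{k_c}) = (⨂_{i∈ι} P_i)(⋂_{c∈𝒞} B^c_{k_c}). (This is the measure-theoretic core of Theorem 1: an arbitrary collection of exogenous distributions can be replaced by discrete ones with finitely many states — at most the number of partition cells per c-component — without changing the joint probabilities of all canonical-partition events.) -/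

import Mathlib

open MeasureTheory
open scoped ENNReal

/-- A set `A` in a product space is *determined by coordinates in `S`* if it is the
preimage, under the restriction map to coordinates in `S`, of a set measurable in the
product σ-algebra over `S`. -/
def DeterminedBy {ι : Type*} {Ω : ι → Type*} [∀ i, MeasurableSpace (Ω i)]
    (A : Set (∀ i, Ω i)) (S : Set ι) : Prop :=
  ∃ C : Set (∀ i : S, Ω i), MeasurableSet C ∧ A = (fun x (i : S) => x i.1) ⁻¹' C

/-- A measure `Q` is *finitely supported with at most `d` atoms* if it is a convex
combination of at most `d` Dirac measures. -/
def FinitelySupportedWith {Ω : Type*} [MeasurableSpace Ω] (Q : Measure Ω) (d : ℕ) : Prop :=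
  ∃ (u : Fin d → Ω) (w : Fin d → ℝ≥0∞),
    (∑ k, w k = 1) ∧ Q = ∑ k, w k • Measure.dirac (u k)

open ProbabilityTheory in
theorem measure_pi_inter_of_determinedBy {ι : Type*} [Fintype ι] {Ω : ι → Type*}
    [∀ i, MeasurableSpace (Ω i)] (Q : ∀ i, Measure (Ω i)) [∀ i, IsProbabilityMeasure (Q i)]
    {S T : Set ι} (hST : Disjoint S T) {A B : Set (∀ i, Ω i)}
    (hA : DeterminedBy A S) (hB : DeterminedBy B T) :
    Measure.pi Q (A ∩ B) = Measure.pi Q A * Measure.pi Q B := by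
  classical
  obtain ⟨S, rfl⟩ := S.toFinite.exists_finset_coe
  obtain ⟨T, rfl⟩ := T.toFinite.exists_finset_coe
  obtain ⟨C, hC, rfl⟩ := hA
  obtain ⟨D, hD, rfl⟩ := hB
  have hind : iIndepFun (fun i (ω : ∀ i, Ω i) ↦ ω i) (Measure.pi Q) :=
    iIndepFun_pi (X := fun _ ↦ id) fun _ ↦ aemeasurable_id
  exact (hind.indepFun_finset S T (Finset.disjoint_coe.mp hST)
    measurable_pi_apply).measure_inter_preimage_eq_mul C D hC hD

theorem DeterminedBy.mono {ι : Type*} {Ω : ι → Type*} [∀ i, MeasurableSpace (Ω i)]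
    {A : Set (∀ i, Ω i)} {S T : Set ι} (hA : DeterminedBy A S) (hST : S ⊆ T) :
    DeterminedBy A T := by
  obtain ⟨C, hC, rfl⟩ := hA
  exact ⟨(fun x (i : S) ↦ x ⟨i, hST i.2⟩) ⁻¹' C,
    (measurable_pi_lambda _ fun _ ↦ measurable_pi_apply _) hC, rfl⟩

theorem DeterminedBy.inter {ι : Type*} {Ω : ι → Type*} [∀ i, MeasurableSpace (Ω i)]
    {A B : Set (∀ i, Ω i)} {S : Set ι} (hA : DeterminedBy A S) (hB : DeterminedBy B S) :
    DeterminedBy (A ∩ B) S := by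
  obtain ⟨C, hC, rfl⟩ := hA
  obtain ⟨D, hD, rfl⟩ := hB
  exact ⟨C ∩ D, hC.inter hD, rfl⟩

theorem determinedBy_univ {ι : Type*} {Ω : ι → Type*} [∀ i, MeasurableSpace (Ω i)] (S : Set ι) :
    DeterminedBy (Set.univ : Set (∀ i, Ω i)) S :=
  ⟨Set.univ, MeasurableSet.univ, rfl⟩

/-- Membership in a set determined by `S` is insensitive to coordinates outside `S`. -/
theorem DeterminedBy.update_mem_iff {ι : Type*} [DecidableEq ι] {Ω : ι → Type*}
    [∀ i, MeasurableSpace (Ω i)] {A : Set (∀ i, Ω i)} {S : Set ι} (hA : DeterminedBy A S)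
    {i : ι} (hi : i ∉ S) (y : ∀ i, Ω i) (x : Ω i) :
    Function.update y i x ∈ A ↔ y ∈ A := by
  obtain ⟨C, -, rfl⟩ := hA
  have h : (fun j : S ↦ Function.update y i x j) = fun j : S ↦ y j := by
    ext j
    exact Function.update_of_ne (fun h : (j : ι) = i ↦ hi (h ▸ j.2)) x y
  simp only [Set.mem_preimage, h]

/-- Under a product measure, events determined by disjoint blocks of coordinates are mutually
independent. -/
theorem measure_pi_iInter_of_determinedBy {ι κ : Type*} [Fintype ι] [Fintype κ] {Ω : ι → Type*}
    [∀ i, MeasurableSpace (Ω i)] (Q : ∀ i, Measure (Ω i)) [∀ i, IsProbabilityMeasure (Q i)]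
    (π : ι → κ) (A : κ → Set (∀ i, Ω i)) (hA : ∀ c, DeterminedBy (A c) {i | π i = c}) :
    Measure.pi Q (⋂ c, A c) = ∏ c, Measure.pi Q (A c) := by
  classical
  have key (s : Finset κ) : DeterminedBy (⋂ c ∈ s, A c) {i | π i ∈ s} ∧
      Measure.pi Q (⋂ c ∈ s, A c) = ∏ c ∈ s, Measure.pi Q (A c) := by
    induction s using Finset.induction_on with
    | empty => simpa using determinedBy_univ _
    | insert c s hc ih =>
      rw [Finset.set_biInter_insert, Finset.prod_insert hc, ← ih.2]
      refine ⟨((hA c).mono ?_).inter (ih.1.mono ?_),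
        measure_pi_inter_of_determinedBy Q ?_ (hA c) ih.1⟩
      · rintro i rfl
        simp
      · intro i hi
        exact Finset.mem_insert_of_mem hi
      · rw [Set.disjoint_left]
        rintro i rfl h
        exact hc h
  simpa using (key Finset.univ).2

/-- Replacing the `i`-th coordinate of a sample from `⨂ j, Q j` by an independent sample from `ν`
yields a sample from the product measure whose `i`-th factor is `ν`. -/
theorem measurePreserving_update {ι : Type*} [Fintype ι] [DecidableEq ι] {Ω : ι → Type*}
    [∀ i, MeasurableSpace (Ω i)] (Q : ∀ i, Measure (Ω i)) [∀ i, IsProbabilityMeasure (Q i)]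
    (i : ι) (ν : Measure (Ω i)) [IsProbabilityMeasure ν] :
    MeasurePreserving (fun p : Ω i × (∀ j, Ω j) ↦ Function.update p.2 i p.1)
      (ν.prod (Measure.pi Q)) (Measure.pi (Function.update Q i ν)) := by
  have hprob (j : ι) : IsProbabilityMeasure (Function.update Q i ν j) := by
    by_cases h : j = i
    · subst h
      simpa
    · rw [Function.update_of_ne h]
      infer_instance
  have hmeas : Measurable fun p : Ω i × (∀ j, Ω j) ↦ Function.update p.2 i p.1 := by
    refine measurable_pi_lambda _ fun j ↦ ?_
    by_cases h : j = i
    · subst h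
      simpa using measurable_fst
    · simp only [Function.update_of_ne h]
      exact (measurable_pi_apply j).comp measurable_snd
  refine ⟨hmeas, (Measure.pi_eq fun s hs ↦ ?_).symm⟩
  rw [Measure.map_apply hmeas (MeasurableSet.univ_pi hs)]
  have hpre : (fun p : Ω i × (∀ j, Ω j) ↦ Function.update p.2 i p.1) ⁻¹' Set.univ.pi s =
      s i ×ˢ Set.univ.pi (Function.update s i Set.univ) := by
    ext ⟨x, y⟩
    simp only [Set.mem_preimage, Set.mem_univ_pi, Set.mem_prod]
    constructor
    · intro h
      refine ⟨by simpa using h i, fun j ↦ ?_⟩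
      by_cases hj : j = i
      · subst hj
        simp
      · simpa [hj] using h j
    · rintro ⟨hx, hy⟩ j
      by_cases hj : j = i
      · subst hj
        simpa
      · simpa [hj] using hy j
  rw [hpre, Measure.prod_prod, Measure.pi_pi, ← Finset.mul_prod_erase _ _ (Finset.mem_univ i),
    ← Finset.mul_prod_erase _ _ (Finset.mem_univ i)]
  simp only [Function.update_self, measure_univ, one_mul]
  congr 1
  refine Finset.prod_congr rfl fun j hj ↦ ?_
  simp [Finset.ne_of_mem_erase hj]

theorem measure_pi_update {ι : Type*} [Fintype ι] [DecidableEq ι] {Ω : ι → Type*}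
    [∀ i, MeasurableSpace (Ω i)] (Q : ∀ i, Measure (Ω i)) [∀ i, IsProbabilityMeasure (Q i)]
    (i : ι) (ν : Measure (Ω i)) [IsProbabilityMeasure ν] {A : Set (∀ i, Ω i)}
    (hA : MeasurableSet A) :
    Measure.pi (Function.update Q i ν) A =
      ∫⁻ x, Measure.pi Q ((fun y ↦ Function.update y i x) ⁻¹' A) ∂ν := by
  have h := measurePreserving_update Q i ν
  rw [← h.measure_preimage hA.nullMeasurableSet, Measure.prod_apply (h.measurable hA)]
  rfl

/-- In a finite-dimensional space, the mean of a random vector taking values in a convex set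
belongs to that set, even when the set is not closed. -/
theorem Convex.integral_mem_of_finiteDimensional {Ω E : Type*} [MeasurableSpace Ω]
    {μ : Measure Ω} [IsProbabilityMeasure μ] [NormedAddCommGroup E] [NormedSpace ℝ E]
    [FiniteDimensional ℝ E] {X : Set E} (hX : Convex ℝ X) {f : Ω → E} (hf : Integrable f μ)
    (hfX : ∀ᵐ x ∂μ, f x ∈ X) : ∫ x, f x ∂μ ∈ X := by
  induction h : Module.finrank ℝ E using Nat.strong_induction_on generalizing E with
  | _ n ih =>
  subst h
  by_contra hm
  set m := ∫ x, f x ∂μ with hmdef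
  obtain ⟨y₀, hy₀⟩ : X.Nonempty := hfX.exists.imp' f fun _ ↦ id
  -- It suffices to find a nonzero functional that is almost surely constant along `f`.
  obtain ⟨l, hl, hlf⟩ : ∃ l : StrongDual ℝ E, l ≠ 0 ∧ ∀ᵐ x ∂μ, l (f x) = l m := by
    have hlm (l : StrongDual ℝ E) : ∫ x, l (f x) ∂μ = l m := l.integral_comp_comm hf
    by_cases hint : (interior X).Nonempty
    · obtain ⟨l, hl, hle⟩ := geometric_hahn_banach_of_nonempty_interior_point hX
        (fun h ↦ hm (interior_subset h)) hint
      refine ⟨l, hl, ?_⟩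
      have hnonneg : 0 ≤ᵐ[μ] fun x ↦ l m - l (f x) := by
        filter_upwards [hfX] with x hx
        simpa using hle _ hx
      have hli : Integrable (fun x ↦ l (f x)) μ := l.integrable_comp hf
      have := (integral_eq_zero_iff_of_nonneg_ae hnonneg ((integrable_const _).sub hli)).1
        (by rw [integral_sub (integrable_const _) hli, hlm]; simp)
      filter_upwards [this] with x hx
      exact (sub_eq_zero.1 hx).symm
    · rw [hX.interior_nonempty_iff_affineSpan_eq_top] at hint
      have hdir : (affineSpan ℝ X).direction < ⊤ := by
        rw [lt_top_iff_ne_top, Ne, AffineSubspace.direction_eq_top_iff_of_nonempty]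
        · exact hint
        · exact ⟨y₀, subset_affineSpan ℝ X hy₀⟩
      obtain ⟨l, hl, hle⟩ := Submodule.exists_le_ker_of_lt_top _ hdir
      let l' : StrongDual ℝ E := LinearMap.toContinuousLinearMap l
      have hconst : ∀ᵐ x ∂μ, l' (f x) = l' y₀ := by
        filter_upwards [hfX] with x hx
        have := hle (AffineSubspace.vsub_mem_direction (subset_affineSpan ℝ X hx)
          (subset_affineSpan ℝ X hy₀))
        simpa [l', sub_eq_zero] using this
      refine ⟨l', fun h ↦ hl (by simpa [l'] using h), ?_⟩
      rw [← hlm, integral_congr_ae hconst]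
      simpa using hconst
  obtain ⟨p, hp⟩ := Submodule.ClosedComplemented.of_finiteDimensional (LinearMap.ker l.toLinearMap)
  have hlt : Module.finrank ℝ (LinearMap.ker l.toLinearMap) < Module.finrank ℝ E := by
    refine Submodule.finrank_lt fun h ↦ hl ?_
    ext x
    simpa using LinearMap.congr_fun (LinearMap.ker_eq_top.1 h) x
  have hfi : Integrable (fun x ↦ f x - m) μ := hf.sub (integrable_const m)
  have hmem := ih _ hlt (E := LinearMap.ker l.toLinearMap) (X := {v | (v : E) + m ∈ X})
    (f := fun x ↦ p (f x - m))
    (by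
      intro v hv w hw a b ha hb hab
      have := hX hv hw ha hb hab
      have e : a • ((v : E) + m) + b • ((w : E) + m) = (a • (v : E) + b • (w : E)) + m := by
        rw [smul_add, smul_add, add_add_add_comm, ← add_smul, hab, one_smul]
      rw [e] at this
      simpa using this)
    (p.integrable_comp hfi)
    (by
      filter_upwards [hfX, hlf] with x hx hlx
      have := hp ⟨f x - m, by simp [hlx]⟩
      simp only at this
      simpa [this] using hx)
    rfl
  rw [p.integral_comp_comm hfi, integral_sub hf (integrable_const m), ← hmdef] at hmem
  simp [hm] at hmem

/-- A probability measure can be replaced by one with at most `d` atoms without changing the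
integrals of `d` functions that sum to one. -/
theorem exists_finitelySupportedWith_lintegral_eq {Ω : Type*} [MeasurableSpace Ω]
    (μ : Measure Ω) [IsProbabilityMeasure μ] {d : ℕ} (g : Fin d → Ω → ℝ≥0∞)
    (hg : ∀ k, Measurable (g k)) (hsum : ∀ x, ∑ k, g k x = 1) :
    ∃ ν : Measure Ω, IsProbabilityMeasure ν ∧ FinitelySupportedWith ν d ∧
      ∀ k, ∫⁻ x, g k x ∂ν = ∫⁻ x, g k x ∂μ := by
  classical
  have hle (k : Fin d) (x : Ω) : g k x ≤ 1 :=
    (Finset.single_le_sum (f := fun k ↦ g k x) (fun _ _ ↦ zero_le) (Finset.mem_univ k)).trans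
      (hsum x).le
  have hfin (k : Fin d) (x : Ω) : g k x ≠ ∞ := ne_top_of_le_ne_top ENNReal.one_ne_top (hle k x)
  let f : Ω → Fin d → ℝ := fun x k ↦ (g k x).toReal
  have hfk (k : Fin d) : Integrable (fun x ↦ f x k) μ := by
    refine Integrable.of_bound (hg k).ennreal_toReal.aestronglyMeasurable 1 (ae_of_all _ fun x ↦ ?_)
    rw [Real.norm_of_nonneg ENNReal.toReal_nonneg]
    simpa using ENNReal.toReal_mono ENNReal.one_ne_top (hle k x)
  have hf : Integrable f μ := Integrable.of_eval hfk
  have hfsum (x : Ω) : ∑ k, f x k = 1 := by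
    simp only [f]
    rw [← ENNReal.toReal_sum fun k _ ↦ hfin k x, hsum, ENNReal.toReal_one]
  have hmean := (convex_convexHull ℝ (Set.range f)).integral_mem_of_finiteDimensional hf
    (ae_of_all _ fun x ↦ subset_convexHull ℝ _ ⟨x, rfl⟩)
  obtain ⟨J, _, z, w, hz, hind, hw, hw1, hwz⟩ := eq_pos_convex_span_of_mem_convexHull hmean
  choose u hu using fun j ↦ hz ⟨j, rfl⟩
  have hlin : LinearIndependent ℝ z := by
    rw [Fintype.linearIndependent_iff]
    intro a ha j
    refine affineIndependent_iff.1 hind Finset.univ a ?_ ha j (Finset.mem_univ j)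
    have := congrArg (fun v : Fin d → ℝ ↦ ∑ k, v k) ha
    simp only [Finset.sum_apply, Pi.smul_apply, smul_eq_mul, Pi.zero_apply,
      Finset.sum_const_zero] at this
    rw [Finset.sum_comm] at this
    simpa [← Finset.mul_sum, ← hu, hfsum] using this
  have hcard : Fintype.card J ≤ Fintype.card (Fin d) := by
    simpa using hlin.fintype_card_le_finrank
  obtain ⟨e⟩ := Function.Embedding.nonempty_of_card_le hcard
  obtain ⟨x₀⟩ := nonempty_of_isProbabilityMeasure μ
  let u' : Fin d → Ω := Function.extend e u fun _ ↦ x₀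
  let w' : Fin d → ℝ≥0∞ := Function.extend e (fun j ↦ ENNReal.ofReal (w j)) 0
  have hsum' (h : Ω → ℝ≥0∞) : ∑ k, w' k * h (u' k) = ∑ j, ENNReal.ofReal (w j) * h (u j) := by
    symm
    refine Fintype.sum_of_injective e e.injective _ _ (fun k hk ↦ ?_) fun j ↦ ?_
    · have hk' : ¬ ∃ j, e j = k := hk
      simp [w', Function.extend_apply' _ _ _ hk']
    · simp [w', u', e.injective.extend_apply]
  have hw' : ∑ k, w' k = 1 := by
    have := hsum' fun _ ↦ 1
    simp only [mul_one] at this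
    rw [this, ← ENNReal.ofReal_sum_of_nonneg fun j _ ↦ (hw j).le, hw1, ENNReal.ofReal_one]
  refine ⟨∑ k, w' k • Measure.dirac (u' k), ⟨by simpa using hw'⟩, ⟨u', w', hw', rfl⟩, fun k ↦ ?_⟩
  rw [lintegral_finsetSum_measure]
  simp only [lintegral_smul_measure, lintegral_dirac' _ (hg k), smul_eq_mul]
  have hk : ∑ j, w j * f (u j) k = ∫ x, f x k ∂μ := by
    have := congrFun hwz k
    rw [eval_integral fun k ↦ hfk k] at this
    simpa [← hu] using this
  have hgi : ENNReal.ofReal (∫ x, f x k ∂μ) = ∫⁻ x, g k x ∂μ := by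
    rw [ofReal_integral_eq_lintegral_ofReal (hfk k) (ae_of_all _ fun x ↦ ENNReal.toReal_nonneg)]
    exact lintegral_congr fun x ↦ ENNReal.ofReal_toReal (hfin k x)
  rw [hsum', ← hgi, ← hk,
    ENNReal.ofReal_sum_of_nonneg fun j _ ↦ mul_nonneg (hw j).le ENNReal.toReal_nonneg]
  refine Finset.sum_congr rfl fun j _ ↦ ?_
  rw [ENNReal.ofReal_mul (hw j).le, ENNReal.ofReal_toReal (hfin k _)]

/-- Partition the (finite) index set `ι` into blocks, encoded as the fibers
of a surjection `π : ι → κ`.  For each block `c : κ` we are given a finite measurable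
partition `B c 1, …, B c (d c)` of the product space, each cell determined by the
coordinates in block `c`.  Then the exogenous measures `P i` may be replaced by finitely
supported measures `Q i` (with at most `d (π i)` atoms for `i` in block `π i`) without
changing the product probability of any intersection `⋂ c, B c (k c)`. -/
theorem discretization_of_exogenous_distributions
    {ι κ : Type*} [Fintype ι] [Fintype κ]
    {Ω : ι → Type*} [∀ i, MeasurableSpace (Ω i)]
    (P : ∀ i, Measure (Ω i)) [∀ i, IsProbabilityMeasure (P i)]
    (π : ι → κ) (hπ : Function.Surjective π)
    (d : κ → ℕ)
    (B : ∀ c : κ, Fin (d c) → Set (∀ i, Ω i))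
    (hBmeas : ∀ c k, MeasurableSet (B c k))
    (hBdisj : ∀ c, Pairwise (Function.onFun Disjoint (B c)))
    (hBunion : ∀ c, (⋃ k, B c k) = Set.univ)
    (hBdet : ∀ c k, DeterminedBy (B c k) {i | π i = c}) :
    ∃ Q : ∀ i, Measure (Ω i),
      (∀ i, IsProbabilityMeasure (Q i)) ∧
      (∀ i, FinitelySupportedWith (Q i) (d (π i))) ∧
      ∀ k : ∀ c, Fin (d c),
        Measure.pi Q (⋂ c, B c (k c)) = Measure.pi P (⋂ c, B c (k c)) := by
  classical
  have key (s : Finset ι) : ∃ Q : ∀ i, Measure (Ω i), (∀ i, IsProbabilityMeasure (Q i)) ∧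
      (∀ i ∈ s, FinitelySupportedWith (Q i) (d (π i))) ∧
      ∀ c k, Measure.pi Q (B c k) = Measure.pi P (B c k) := by
    induction s using Finset.induction_on with
    | empty => exact ⟨P, inferInstance, by simp, fun _ _ ↦ rfl⟩
    | insert i s hi ih =>
      obtain ⟨Q, hQ, hQs, hQB⟩ := ih
      have hupd (x : Ω i) : Measurable fun y : ∀ j, Ω j ↦ Function.update y i x :=
        measurable_update_left
      obtain ⟨ν, hν, hνd, hνB⟩ := exists_finitelySupportedWith_lintegral_eq (Q i)
        (fun k x ↦ Measure.pi Q ((fun y ↦ Function.update y i x) ⁻¹' B (π i) k))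
        (fun k ↦ measurable_measure_prodMk_left
          ((measurePreserving_update Q i (Q i)).measurable (hBmeas (π i) k)))
        (fun x ↦ by
          rw [← tsum_fintype (L := .unconditional _), ← measure_iUnion
            (fun k l hkl ↦ (hBdisj (π i) hkl).preimage _) fun k ↦ hupd x (hBmeas (π i) k),
            ← Set.preimage_iUnion, hBunion]
          simp)
      refine ⟨Function.update Q i ν, fun j ↦ ?_, fun j hj ↦ ?_, fun c k ↦ ?_⟩
      · by_cases h : j = i
        · subst h
          simpa
        · rw [Function.update_of_ne h]
          exact hQ j
      · by_cases h : j = i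
        · subst h
          simpa
        · rw [Function.update_of_ne h]
          exact hQs j (Finset.mem_of_mem_insert_of_ne hj h)
      · rw [← hQB, measure_pi_update Q i ν (hBmeas c k)]
        by_cases hc : π i = c
        · subst hc
          rw [hνB, ← measure_pi_update Q i (Q i) (hBmeas _ k), Function.update_eq_self]
        · have hpre (x : Ω i) : (fun y ↦ Function.update y i x) ⁻¹' B c k = B c k :=
            Set.ext fun y ↦ (hBdet c k).update_mem_iff hc y x
          simp [hpre]
  obtain ⟨Q, hQ, hQs, hQB⟩ := key Finset.univ
  refine ⟨Q, hQ, fun i ↦ hQs i (Finset.mem_univ i), fun k ↦ ?_⟩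
  rw [measure_pi_iInter_of_determinedBy Q π _ fun c ↦ hBdet c (k c),
    measure_pi_iInter_of_determinedBy P π _ fun c ↦ hBdet c (k c)]
  exact Finset.prod_congr rfl fun c _ ↦ hQB c (k c)
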